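/- Let (X, A_X) be a finite network with n nodes, with dissimilarities arranged in the n×n matrix A_X. Then the nonreciprocal ultrametric can be computed via dioid matrix powers as u^{NR}_X = max(A_X^{n−1}, (A_X^T)^{n−1}), where the powers are (n−1)-th dioid powers in the min-max dioid algebra and the maximum of matrices is taken entrywise. -/

import Mathlib

noncomputable section

/-- Cost of a chain (a finite ordered list of nodes): the maximum dissimilarity
encountered over consecutive pairs (0 for chains with fewer than two nodes). -/
def chainCost {X : Type*} (A : X → X → ℝ) : List X → ℝ
  | [] => 0
  | [_] => 0
  | a :: b :: rest => max (A a b) (chainCost A (b :: rest))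

/-- The set of costs of chains from `x` to `x'`. -/
def chainCosts {X : Type*} (A : X → X → ℝ) (x x' : X) : Set ℝ :=
  { c | ∃ l : List X, l.head? = some x ∧ l.getLast? = some x' ∧ chainCost A l = c }

/-- Directed minimum chain cost ũ*(x,x'). -/
def minChainCost {X : Type*} (A : X → X → ℝ) (x x' : X) : ℝ :=
  sInf (chainCosts A x x')

/-- The reciprocal ultrametric u^R. -/
def uR {X : Type*} (A : X → X → ℝ) (x x' : X) : ℝ :=
  minChainCost (fun a b => max (A a b) (A b a)) x x'

/-- The nonreciprocal ultrametric u^NR. -/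
def uNR {X : Type*} (A : X → X → ℝ) (x x' : X) : ℝ :=
  max (minChainCost A x x') (minChainCost A x' x)

/-- The set of costs of chains from `x` to `x'` having at most `t` nodes. -/
def boundedChainCosts {X : Type*} (A : X → X → ℝ) (t : ℕ) (x x' : X) : Set ℝ :=
  { c | ∃ l : List X, l.head? = some x ∧ l.getLast? = some x' ∧ l.length ≤ t ∧
      chainCost A l = c }

/-- A^{SR(t)}(x,x'): minimum cost over chains from `x` to `x'` with at most `t` nodes. -/
def ASR {X : Type*} (A : X → X → ℝ) (t : ℕ) (x x' : X) : ℝ :=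
  sInf (boundedChainCosts A t x x')

/-- The semi-reciprocal ultrametric u^{SR(t)}. -/
def uSR {X : Type*} (A : X → X → ℝ) (t : ℕ) (x x' : X) : ℝ :=
  minChainCost (fun a b => max (ASR A t a b) (ASR A t b a)) x x'

/-- The min-max dioid product of square matrices. -/
def dioidMul {n : ℕ} (A B : Fin n → Fin n → ℝ) : Fin n → Fin n → ℝ :=
  fun i j => ⨅ k : Fin n, max (A i k) (B k j)

/-- Dioid powers: `dioidPow A l` is the `l`-th power `A^l` of `A` in the min-max
dioid algebra (with the convention `A^0 = A`, which is never used for `l ≥ 1`). -/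
def dioidPow {n : ℕ} (A : Fin n → Fin n → ℝ) : ℕ → Fin n → Fin n → ℝ
  | 0 => A
  | 1 => A
  | (k + 2) => dioidMul A (dioidPow A (k + 1))

/-- A bound on the cost of a chain is a bound on each of its links. -/
theorem chainCost_le_iff {X : Type*} {A : X → X → ℝ} {c : ℝ} (hc : 0 ≤ c) (l : List X) :
    chainCost A l ≤ c ↔ l.IsChain (fun a b => A a b ≤ c) := by
  induction l using chainCost.induct with
  | case1 => simpa [chainCost] using hc
  | case2 => simpa [chainCost] using hc
  | case3 a b rest ih => simp [chainCost, ih]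

theorem chainCost_nonneg {X : Type*} (A : X → X → ℝ) (l : List X) : 0 ≤ chainCost A l := by
  induction l using chainCost.induct with
  | case1 => simp [chainCost]
  | case2 => simp [chainCost]
  | case3 a b rest ih => exact le_max_of_le_right ih

theorem chainCost_reverse_le {X : Type*} (A : X → X → ℝ) (l : List X) :
    chainCost (fun a b => A b a) l.reverse ≤ chainCost A l := by
  rw [chainCost_le_iff (chainCost_nonneg A l), List.isChain_reverse]
  exact (chainCost_le_iff (chainCost_nonneg A l) l).1 le_rfl

theorem chainCost_reverse {X : Type*} (A : X → X → ℝ) (l : List X) :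
    chainCost (fun a b => A b a) l.reverse = chainCost A l := by
  refine le_antisymm (chainCost_reverse_le A l) ?_
  simpa using chainCost_reverse_le (fun a b => A b a) l.reverse

theorem chainCosts_swap {X : Type*} (A : X → X → ℝ) (x y : X) :
    chainCosts (fun a b => A b a) x y = chainCosts A y x := by
  ext c
  constructor
  · rintro ⟨l, hx, hy, rfl⟩
    exact ⟨l.reverse, by simpa using hy, by simpa using hx,
      chainCost_reverse (fun a b => A b a) l⟩
  · rintro ⟨l, hy, hx, rfl⟩
    exact ⟨l.reverse, by simpa using hx, by simpa using hy, chainCost_reverse A l⟩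

theorem minChainCost_swap {X : Type*} (A : X → X → ℝ) (x y : X) :
    minChainCost (fun a b => A b a) x y = minChainCost A y x := by
  rw [minChainCost, chainCosts_swap, minChainCost]

/-- Cutting out cycles turns a chain into one without repeated nodes, at no extra cost. -/
theorem exists_nodup_chainCost_le {X : Type*} (A : X → X → ℝ) {x y : X} (l : List X)
    (hx : l.head? = some x) (hy : l.getLast? = some y) :
    ∃ l' : List X, l'.head? = some x ∧ l'.getLast? = some y ∧ l'.Nodup ∧
      chainCost A l' ≤ chainCost A l := by
  induction l using chainCost.induct generalizing x with
  | case1 => simp at hx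
  | case2 a => exact ⟨[a], hx, hy, by simp, le_rfl⟩
  | case3 a b rest ih =>
    obtain rfl : a = x := by simpa using hx
    obtain ⟨t, hb, ht, hnd, hle⟩ := ih (x := b) rfl (by simpa using hy)
    by_cases ha : a ∈ t
    · obtain ⟨s, r, rfl⟩ := List.append_of_mem ha
      refine ⟨a :: r, rfl, by simpa using ht, hnd.of_append_right, ?_⟩
      refine le_trans ?_ (le_max_of_le_right hle)
      have hc := chainCost_nonneg A (s ++ a :: r)
      rw [chainCost_le_iff hc]
      exact ((chainCost_le_iff hc _).1 le_rfl).suffix (List.suffix_append s _)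
    · cases t with
      | nil => simp at hb
      | cons b' r =>
        obtain rfl : b' = b := by simpa using hb
        exact ⟨a :: b' :: r, rfl, by simpa using ht, List.nodup_cons.2 ⟨ha, hnd⟩,
          max_le_max le_rfl hle⟩

/-- Every entry of a dioid power is the cost of some chain. -/
theorem dioidPow_mem_chainCosts {n : ℕ} (A : Fin n → Fin n → ℝ)
    (hnonneg : ∀ i j, 0 ≤ A i j) (k : ℕ) (i j : Fin n) :
    dioidPow A k i j ∈ chainCosts A i j := by
  induction k using dioidPow.induct generalizing i with
  | case1 => exact ⟨[i, j], rfl, rfl, max_eq_left (hnonneg i j)⟩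
  | case2 => exact ⟨[i, j], rfl, rfl, max_eq_left (hnonneg i j)⟩
  | case3 k ih =>
    have : Nonempty (Fin n) := ⟨i⟩
    obtain ⟨m, hm⟩ := exists_eq_ciInf_of_finite
      (f := fun m : Fin n => max (A i m) (dioidPow A (k + 1) m j))
    obtain ⟨l, hl, hj, hc⟩ := ih m
    cases l with
    | nil => simp at hl
    | cons m' r =>
      obtain rfl : m' = m := by simpa using hl
      refine ⟨i :: m' :: r, rfl, by simpa using hj, ?_⟩
      rw [chainCost, hc]
      exact hm

/-- The `k`-th dioid power is dominated by the cost of every chain with at most `k` links. -/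
theorem dioidPow_le_chainCost {n : ℕ} (A : Fin n → Fin n → ℝ)
    (hdiag : ∀ i, A i i = 0) (k : ℕ) {i j : Fin n} (l : List (Fin n))
    (hi : l.head? = some i) (hj : l.getLast? = some j) (hl : l.length ≤ k + 1) :
    dioidPow A k i j ≤ chainCost A l := by
  induction k using dioidPow.induct generalizing i l with
  | case1 =>
    match l, hi, hj, hl with
    | [a], hi, hj, _ =>
      obtain rfl : a = i := by simpa using hi
      obtain rfl : a = j := by simpa using hj
      exact (hdiag a).le
  | case2 =>
    match l, hi, hj, hl with
    | [a], hi, hj, _ =>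
      obtain rfl : a = i := by simpa using hi
      obtain rfl : a = j := by simpa using hj
      exact (hdiag a).le
    | [a, b], hi, hj, _ =>
      obtain rfl : a = i := by simpa using hi
      obtain rfl : b = j := by simpa using hj
      exact le_max_left _ _
  | case3 k ih =>
    have hinf (m : Fin n) : dioidPow A (k + 2) i j ≤ max (A i m) (dioidPow A (k + 1) m j) :=
      ciInf_le (f := fun m => max (A i m) (dioidPow A (k + 1) m j))
        (Set.finite_range _).bddBelow m
    match l, hi, hj, hl with
    | [a], hi, hj, _ =>
      obtain rfl : a = i := by simpa using hi
      exact (hinf a).trans (max_le (hdiag a).le (ih [a] rfl hj (by simp)))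
    | a :: b :: r, hi, hj, hl =>
      obtain rfl : a = i := by simpa using hi
      exact (hinf b).trans (max_le_max le_rfl
        (ih (b :: r) rfl (by simpa using hj) (by simpa using hl)))

theorem dioidPow_eq_minChainCost {n : ℕ} (A : Fin n → Fin n → ℝ)
    (hnonneg : ∀ i j, 0 ≤ A i j) (hdiag : ∀ i, A i i = 0) (i j : Fin n) :
    dioidPow A (n - 1) i j = minChainCost A i j := by
  have hleast : IsLeast (chainCosts A i j) (dioidPow A (n - 1) i j) := by
    refine ⟨dioidPow_mem_chainCosts A hnonneg _ i j, ?_⟩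
    rintro _ ⟨l, hi, hj, rfl⟩
    obtain ⟨l', hi', hj', hnd, hle⟩ := exists_nodup_chainCost_le A l hi hj
    refine (dioidPow_le_chainCost A hdiag (n - 1) l' hi' hj' ?_).trans hle
    have hcard : l'.length ≤ n := by simpa using hnd.length_le_card
    omega
  exact hleast.csInf_eq.symm

/-- the nonreciprocal ultrametric equals the entrywise maximum of
the (n−1)-th dioid powers of A and of its transpose Aᵀ. -/
theorem nonreciprocal_eq_dioid_power (n : ℕ) (A : Fin n → Fin n → ℝ)
    (hnonneg : ∀ i j : Fin n, 0 ≤ A i j)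
    (hid : ∀ i j : Fin n, A i j = 0 ↔ i = j) :
    ∀ i j : Fin n,
      uNR A i j =
        max (dioidPow A (n - 1) i j) (dioidPow (fun a b => A b a) (n - 1) i j) := by
  intro i j
  have hdiag (a : Fin n) : A a a = 0 := (hid a a).2 rfl
  rw [dioidPow_eq_minChainCost A hnonneg hdiag,
    dioidPow_eq_minChainCost _ (fun a b => hnonneg b a) hdiag, minChainCost_swap A i j, uNR]
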